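/- Assume a₀₃ ≠ 0 and sin²(α)·κ₂ ≠ κ₁ (so E₁ is an immersion near (0,0)). Then the Gaussian curvature K̃ of the evolutoid E₁ vanishes at (0,0) (i.e. the point p = E₁(0,0) is a parabolic point of the evolutoid) if and only if a₂₁ = 0 (i.e. if and only if the origin is a sub-parabolic point of S with respect to ∂_u). -/

import Mathlib

noncomputable section

open Real

def dot3 (a b : Fin 3 → ℝ) : ℝ := a 0 * b 0 + a 1 * b 1 + a 2 * b 2

def cross3 (a b : Fin 3 → ℝ) : Fin 3 → ℝ :=
  ![a 1 * b 2 - a 2 * b 1, a 2 * b 0 - a 0 * b 2, a 0 * b 1 - a 1 * b 0]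

def norm3 (a : Fin 3 → ℝ) : ℝ := Real.sqrt (dot3 a a)

noncomputable def pdu {X : Type*} [NormedAddCommGroup X] [NormedSpace ℝ X]
    (f : ℝ × ℝ → X) : ℝ × ℝ → X := fun p => deriv (fun t => f (t, p.2)) p.1

noncomputable def pdv {X : Type*} [NormedAddCommGroup X] [NormedSpace ℝ X]
    (f : ℝ × ℝ → X) : ℝ × ℝ → X := fun p => deriv (fun t => f (p.1, t)) p.2

noncomputable def pd (i j : ℕ) (f : ℝ × ℝ → ℝ) : ℝ × ℝ → ℝ :=
  (pdu (X := ℝ))^[i] ((pdv (X := ℝ))^[j] f)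

def mongeSurf (f : ℝ × ℝ → ℝ) : ℝ × ℝ → Fin 3 → ℝ := fun p => ![p.1, p.2, f p]

noncomputable def unitNormal (ψ : ℝ × ℝ → Fin 3 → ℝ) : ℝ × ℝ → Fin 3 → ℝ := fun p =>
  (norm3 (cross3 (pdu ψ p) (pdv ψ p)))⁻¹ • cross3 (pdu ψ p) (pdv ψ p)

noncomputable def coefE (f : ℝ × ℝ → ℝ) : ℝ × ℝ → ℝ := fun p => 1 + (pdu f p) ^ 2
noncomputable def coefG (f : ℝ × ℝ → ℝ) : ℝ × ℝ → ℝ := fun p => 1 + (pdv f p) ^ 2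

noncomputable def kap2 (f : ℝ × ℝ → ℝ) : ℝ × ℝ → ℝ := fun p =>
  dot3 (pdv (pdv (mongeSurf f)) p) (unitNormal (mongeSurf f) p) / coefG f p

noncomputable def rfun (α : ℝ) (f : ℝ × ℝ → ℝ) : ℝ × ℝ → ℝ := fun p =>
  -(2 * Real.sqrt (coefE f p) * coefG f p) /
    (Real.cos α * pdu (coefG f) p -
      2 * Real.sin α * Real.sqrt (coefE f p) * coefG f p * kap2 f p)

noncomputable def evolutoid (α : ℝ) (f : ℝ × ℝ → ℝ) : ℝ × ℝ → Fin 3 → ℝ := fun p =>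
  mongeSurf f p +
    rfun α f p •
      ((Real.cos α / Real.sqrt (coefE f p)) • pdu (mongeSurf f) p +
        Real.sin α • unitNormal (mongeSurf f) p)

def MongeHyp (κ₁ κ₂ : ℝ) (a : ℕ → ℕ → ℝ) (f : ℝ × ℝ → ℝ) : Prop :=
  ContDiff ℝ (⊤ : ℕ∞) f ∧ f (0, 0) = 0 ∧
    pdu f (0, 0) = 0 ∧ pdv f (0, 0) = 0 ∧
    pd 2 0 f (0, 0) = κ₁ ∧ pd 1 1 f (0, 0) = 0 ∧ pd 0 2 f (0, 0) = κ₂ ∧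
    ∀ i j : ℕ, 3 ≤ i + j → i + j ≤ 4 → pd i j f (0, 0) = a i j

noncomputable def gaussK (ψ : ℝ × ℝ → Fin 3 → ℝ) : ℝ × ℝ → ℝ := fun p =>
  (dot3 (pdu (pdu ψ) p) (unitNormal ψ p) * dot3 (pdv (pdv ψ) p) (unitNormal ψ p) -
      dot3 (pdu (pdv ψ) p) (unitNormal ψ p) ^ 2) /
    (norm3 (pdu ψ p) ^ 2 * norm3 (pdv ψ p) ^ 2 - (dot3 (pdu ψ p) (pdv ψ p)) ^ 2)

def AEquivalentAt {E F : Type*} [NormedAddCommGroup E] [NormedSpace ℝ E]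
    [NormedAddCommGroup F] [NormedSpace ℝ F]
    (f : E → F) (p : E) (g : E → F) (q : E) : Prop :=
  ∃ (h : PartialHomeomorph E E) (ξ : PartialHomeomorph F F),
    p ∈ h.source ∧ h p = q ∧
    ContDiffOn ℝ (⊤ : ℕ∞) h h.source ∧ ContDiffOn ℝ (⊤ : ℕ∞) h.symm h.target ∧
    f p ∈ ξ.source ∧ ξ (f p) = g q ∧
    ContDiffOn ℝ (⊤ : ℕ∞) ξ ξ.source ∧ ContDiffOn ℝ (⊤ : ℕ∞) ξ.symm ξ.target ∧
    ∀ᶠ x in nhds p, ξ (f x) = g (h x)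

section PartialDerivatives

variable {X : Type*} [NormedAddCommGroup X] [NormedSpace ℝ X] {g h : ℝ × ℝ → X} {p : ℝ × ℝ}

lemma DifferentiableAt.hasDerivAt_pdu (hg : DifferentiableAt ℝ g p) :
    HasDerivAt (fun t => g (t, p.2)) (pdu g p) p.1 := by
  have hd : DifferentiableAt ℝ (fun t : ℝ => g (t, p.2)) p.1 :=
    DifferentiableAt.comp (g := g) p.1 hg (by fun_prop)
  exact hd.hasDerivAt

lemma DifferentiableAt.hasDerivAt_pdv (hg : DifferentiableAt ℝ g p) :
    HasDerivAt (fun t => g (p.1, t)) (pdv g p) p.2 := by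
  have hd : DifferentiableAt ℝ (fun t : ℝ => g (p.1, t)) p.2 :=
    DifferentiableAt.comp (g := g) p.2 hg (by fun_prop)
  exact hd.hasDerivAt

lemma DifferentiableAt.pdu_eq_fderiv (hg : DifferentiableAt ℝ g p) :
    pdu g p = fderiv ℝ g p (1, 0) := by
  have hγ : HasDerivAt (fun t : ℝ => (t, p.2)) ((1 : ℝ), (0 : ℝ)) p.1 :=
    (hasDerivAt_id p.1).prodMk (hasDerivAt_const p.1 p.2)
  exact (HasFDerivAt.comp_hasDerivAt (l := g) p.1 hg.hasFDerivAt hγ).deriv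

lemma DifferentiableAt.pdv_eq_fderiv (hg : DifferentiableAt ℝ g p) :
    pdv g p = fderiv ℝ g p (0, 1) := by
  have hγ : HasDerivAt (fun t : ℝ => (p.1, t)) ((0 : ℝ), (1 : ℝ)) p.2 :=
    (hasDerivAt_const p.2 p.1).prodMk (hasDerivAt_id p.2)
  exact (HasFDerivAt.comp_hasDerivAt (l := g) p.2 hg.hasFDerivAt hγ).deriv

lemma pdu_congr (e : g =ᶠ[nhds p] h) : pdu g p = pdu h p := by
  have hc : Filter.Tendsto (fun t : ℝ => (t, p.2)) (nhds p.1) (nhds p) :=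
    Continuous.tendsto (by fun_prop : Continuous fun t : ℝ => (t, p.2)) p.1
  exact Filter.EventuallyEq.deriv_eq (hc.eventually e)

lemma pdv_congr (e : g =ᶠ[nhds p] h) : pdv g p = pdv h p := by
  have hc : Filter.Tendsto (fun t : ℝ => (p.1, t)) (nhds p.2) (nhds p) :=
    Continuous.tendsto (by fun_prop : Continuous fun t : ℝ => (p.1, t)) p.2
  exact Filter.EventuallyEq.deriv_eq (hc.eventually e)

lemma eventually_differentiableAt {n : ℕ} (hg : ContDiffAt ℝ ((n + 1 : ℕ) : WithTop ℕ∞) g p) :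
    ∀ᶠ q in nhds p, DifferentiableAt ℝ g q := by
  filter_upwards [hg.eventually (by simp)] with q hq
  exact hq.differentiableAt (by simp)

lemma ContDiffAt.pdu {n : ℕ} (hg : ContDiffAt ℝ ((n + 1 : ℕ) : WithTop ℕ∞) g p) :
    ContDiffAt ℝ n (pdu g) p := by
  have h1 : ContDiffAt ℝ n (fun q => fderiv ℝ g q (1, 0)) p :=
    (hg.fderiv_right (m := n) (by norm_cast)).clm_apply contDiffAt_const
  refine h1.congr_of_eventuallyEq ?_
  filter_upwards [eventually_differentiableAt hg] with q hq using hq.pdu_eq_fderiv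

lemma ContDiffAt.pdv {n : ℕ} (hg : ContDiffAt ℝ ((n + 1 : ℕ) : WithTop ℕ∞) g p) :
    ContDiffAt ℝ n (pdv g) p := by
  have h1 : ContDiffAt ℝ n (fun q => fderiv ℝ g q (0, 1)) p :=
    (hg.fderiv_right (m := n) (by norm_cast)).clm_apply contDiffAt_const
  refine h1.congr_of_eventuallyEq ?_
  filter_upwards [eventually_differentiableAt hg] with q hq using hq.pdv_eq_fderiv

lemma ContDiff.pdu (hg : ContDiff ℝ (⊤ : ℕ∞) g) : ContDiff ℝ (⊤ : ℕ∞) (pdu g) :=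
  contDiff_infty.2 fun n => contDiff_iff_contDiffAt.2 fun _ =>
    ((contDiff_infty.1 hg (n + 1)).contDiffAt).pdu

lemma ContDiff.pdv (hg : ContDiff ℝ (⊤ : ℕ∞) g) : ContDiff ℝ (⊤ : ℕ∞) (pdv g) :=
  contDiff_infty.2 fun n => contDiff_iff_contDiffAt.2 fun _ =>
    ((contDiff_infty.1 hg (n + 1)).contDiffAt).pdv

lemma two_le_infty : (2 : WithTop ℕ∞) ≤ ((⊤ : ℕ∞) : WithTop ℕ∞) := by
  change ((2 : ℕ∞) : WithTop ℕ∞) ≤ _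
  exact WithTop.coe_le_coe.2 le_top

lemma pdu_pdv_comm (hg : ContDiff ℝ (⊤ : ℕ∞) g) (p : ℝ × ℝ) :
    pdu (pdv g) p = pdv (pdu g) p := by
  have hd : Differentiable ℝ g := hg.differentiable (by simp)
  have hd2 : DifferentiableAt ℝ (fderiv ℝ g) p :=
    (hg.fderiv_right (m := (⊤ : ℕ∞)) (by simp)).differentiable (by simp) p
  have eu : pdu g = fun q => fderiv ℝ g q (1, 0) := funext fun q => (hd q).pdu_eq_fderiv
  have ev : pdv g = fun q => fderiv ℝ g q (0, 1) := funext fun q => (hd q).pdv_eq_fderiv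
  rw [(hg.pdv.differentiable (by simp) p).pdu_eq_fderiv,
    (hg.pdu.differentiable (by simp) p).pdv_eq_fderiv, eu, ev,
    fderiv_clm_apply hd2 (by fun_prop), fderiv_clm_apply hd2 (by fun_prop)]
  have hs : IsSymmSndFDerivAt ℝ g p :=
    hg.contDiffAt.isSymmSndFDerivAt (by simpa using two_le_infty)
  simpa using hs (1, 0) (0, 1)

lemma pdu_apply {ι : Type*} [Fintype ι] {ψ : ℝ × ℝ → ι → ℝ} (hψ : DifferentiableAt ℝ ψ p)
    (i : ι) : pdu ψ p i = pdu (fun q => ψ q i) p :=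
  ((hasDerivAt_pi.1 hψ.hasDerivAt_pdu i).deriv).symm

lemma pdv_apply {ι : Type*} [Fintype ι] {ψ : ℝ × ℝ → ι → ℝ} (hψ : DifferentiableAt ℝ ψ p)
    (i : ι) : pdv ψ p i = pdv (fun q => ψ q i) p :=
  ((hasDerivAt_pi.1 hψ.hasDerivAt_pdv i).deriv).symm

lemma pdu_sub_mul {l m F : ℝ × ℝ → ℝ} (hl : DifferentiableAt ℝ l p)
    (hm : DifferentiableAt ℝ m p) (hF : DifferentiableAt ℝ F p) :
    pdu (fun q => l q - m q * F q) p = pdu l p - (pdu m p * F p + m p * pdu F p) :=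
  (hl.hasDerivAt_pdu.sub (hm.hasDerivAt_pdu.mul hF.hasDerivAt_pdu)).deriv

lemma pdv_sub_mul {l m F : ℝ × ℝ → ℝ} (hl : DifferentiableAt ℝ l p)
    (hm : DifferentiableAt ℝ m p) (hF : DifferentiableAt ℝ F p) :
    pdv (fun q => l q - m q * F q) p = pdv l p - (pdv m p * F p + m p * pdv F p) :=
  (hl.hasDerivAt_pdv.sub (hm.hasDerivAt_pdv.mul hF.hasDerivAt_pdv)).deriv

lemma pdu_const_sub_mul_add_mul {c : ℝ} {m F n H : ℝ × ℝ → ℝ}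
    (hm : DifferentiableAt ℝ m p) (hF : DifferentiableAt ℝ F p)
    (hn : DifferentiableAt ℝ n p) (hH : DifferentiableAt ℝ H p) :
    pdu (fun q => c - (m q * F q + n q * H q)) p =
      -(pdu m p * F p + m p * pdu F p + (pdu n p * H p + n p * pdu H p)) :=
  (((hm.hasDerivAt_pdu.mul hF.hasDerivAt_pdu).add
    (hn.hasDerivAt_pdu.mul hH.hasDerivAt_pdu)).const_sub c).deriv

lemma pdv_const_sub_mul_add_mul {c : ℝ} {m F n H : ℝ × ℝ → ℝ}
    (hm : DifferentiableAt ℝ m p) (hF : DifferentiableAt ℝ F p)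
    (hn : DifferentiableAt ℝ n p) (hH : DifferentiableAt ℝ H p) :
    pdv (fun q => c - (m q * F q + n q * H q)) p =
      -(pdv m p * F p + m p * pdv F p + (pdv n p * H p + n p * pdv H p)) :=
  (((hm.hasDerivAt_pdv.mul hF.hasDerivAt_pdv).add
    (hn.hasDerivAt_pdv.mul hH.hasDerivAt_pdv)).const_sub c).deriv

lemma pdu_snd (q : ℝ × ℝ) : pdu (fun p : ℝ × ℝ => p.2) q = 0 := by simp [pdu]

lemma pdv_snd (q : ℝ × ℝ) : pdv (fun p : ℝ × ℝ => p.2) q = 1 := by simp [pdv]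

/-- The second partial derivatives of `v - m F` at a zero of `F`. -/
lemma second_partials_snd_sub_mul {m F : ℝ × ℝ → ℝ} (hm : ContDiffAt ℝ 2 m p)
    (hF : ContDiffAt ℝ 2 F p) (h0 : F p = 0) :
    pdu (pdu fun q => q.2 - m q * F q) p = -(2 * pdu m p * pdu F p + m p * pdu (pdu F) p) ∧
    pdu (pdv fun q => q.2 - m q * F q) p =
      -(pdv m p * pdu F p + pdu m p * pdv F p + m p * pdu (pdv F) p) ∧
    pdv (pdv fun q => q.2 - m q * F q) p = -(2 * pdv m p * pdv F p + m p * pdv (pdv F) p) := by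
  have em := eventually_differentiableAt (n := 1) hm
  have eF := eventually_differentiableAt (n := 1) hF
  have dmu := (hm.pdu (n := 1)).differentiableAt (by simp)
  have dmv := (hm.pdv (n := 1)).differentiableAt (by simp)
  have dFu := (hF.pdu (n := 1)).differentiableAt (by simp)
  have dFv := (hF.pdv (n := 1)).differentiableAt (by simp)
  have dm := em.self_of_nhds
  have dF := eF.self_of_nhds
  have eu : (pdu fun q => q.2 - m q * F q) =ᶠ[nhds p]
      fun q => 0 - (pdu m q * F q + m q * pdu F q) := by
    filter_upwards [em, eF] with q h1 h2
    rw [pdu_sub_mul (by fun_prop) h1 h2, pdu_snd]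
  have ev : (pdv fun q => q.2 - m q * F q) =ᶠ[nhds p]
      fun q => 1 - (pdv m q * F q + m q * pdv F q) := by
    filter_upwards [em, eF] with q h1 h2
    rw [pdv_sub_mul (by fun_prop) h1 h2, pdv_snd]
  refine ⟨?_, ?_, ?_⟩
  · rw [pdu_congr eu, pdu_const_sub_mul_add_mul dmu dF dm dFu, h0]; ring
  · rw [pdu_congr ev, pdu_const_sub_mul_add_mul dmv dF dm dFv, h0]; ring
  · rw [pdv_congr ev, pdv_const_sub_mul_add_mul dmv dF dm dFv, h0]; ring

end PartialDerivatives

section Evolutoid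

variable {f : ℝ × ℝ → ℝ}

/-- The length of `φ_u × φ_v` for the Monge form. -/
def mongeArea (f : ℝ × ℝ → ℝ) : ℝ × ℝ → ℝ := fun p => √(pdu f p ^ 2 + pdv f p ^ 2 + 1)

lemma pdu_mongeSurf (hf : Differentiable ℝ f) : pdu (mongeSurf f) = fun p => ![1, 0, pdu f p] := by
  funext p
  refine HasDerivAt.deriv (hasDerivAt_pi.2 fun i => ?_)
  fin_cases i
  · exact hasDerivAt_id _
  · exact hasDerivAt_const _ _
  · exact (hf p).hasDerivAt_pdu

lemma pdv_mongeSurf (hf : Differentiable ℝ f) : pdv (mongeSurf f) = fun p => ![0, 1, pdv f p] := by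
  funext p
  refine HasDerivAt.deriv (hasDerivAt_pi.2 fun i => ?_)
  fin_cases i
  · exact hasDerivAt_const _ _
  · exact hasDerivAt_id _
  · exact (hf p).hasDerivAt_pdv

lemma pdv_pdv_mongeSurf (hf : Differentiable ℝ f) (hf' : Differentiable ℝ (pdv f)) :
    pdv (pdv (mongeSurf f)) = fun p => ![0, 0, pdv (pdv f) p] := by
  rw [pdv_mongeSurf hf]
  funext p
  refine HasDerivAt.deriv (hasDerivAt_pi.2 fun i => ?_)
  fin_cases i
  · exact hasDerivAt_const _ _
  · exact hasDerivAt_const _ _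
  · exact (hf' p).hasDerivAt_pdv

lemma unitNormal_mongeSurf (hf : Differentiable ℝ f) (p : ℝ × ℝ) :
    unitNormal (mongeSurf f) p = (mongeArea f p)⁻¹ • ![-pdu f p, -pdv f p, 1] := by
  have hc : cross3 ![1, 0, pdu f p] ![0, 1, pdv f p] = ![-pdu f p, -pdv f p, 1] := by
    simp [cross3]
  have hn : norm3 ![-pdu f p, -pdv f p, 1] = mongeArea f p := by
    simp [norm3, dot3, mongeArea, ← sq]
  rw [unitNormal, pdu_mongeSurf hf, pdv_mongeSurf hf, hc, hn]

lemma kap2_eq (hf : Differentiable ℝ f) (hf' : Differentiable ℝ (pdv f)) (p : ℝ × ℝ) :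
    kap2 f p = pdv (pdv f) p * (mongeArea f p)⁻¹ / coefG f p := by
  rw [kap2, pdv_pdv_mongeSurf hf hf', unitNormal_mongeSurf hf]
  simp [dot3]

lemma evolutoid_eq (α : ℝ) (hf : Differentiable ℝ f) : evolutoid α f = fun p =>
    ![p.1 + rfun α f p * (cos α / √(coefE f p) - sin α * (mongeArea f p)⁻¹ * pdu f p),
      p.2 - rfun α f p * sin α * (mongeArea f p)⁻¹ * pdv f p,
      f p + rfun α f p * (cos α / √(coefE f p) * pdu f p + sin α * (mongeArea f p)⁻¹)] := by
  funext p i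
  rw [evolutoid, pdu_mongeSurf hf, unitNormal_mongeSurf hf, mongeSurf]
  fin_cases i <;> simp [-mul_eq_mul_left_iff] <;> ring

lemma rfun_eq (α : ℝ) (hf : ContDiff ℝ (⊤ : ℕ∞) f) : rfun α f = fun p =>
    -(2 * √(coefE f p) * coefG f p) / (cos α * (2 * pdv f p * pdu (pdv f) p) -
      2 * sin α * √(coefE f p) * (pdv (pdv f) p * (mongeArea f p)⁻¹)) := by
  funext p
  have hv : Differentiable ℝ (pdv f) := hf.pdv.differentiable (by simp)
  have hG : pdu (coefG f) p = 2 * pdv f p * pdu (pdv f) p := by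
    have := (((hv p).hasDerivAt_pdu.pow 2).const_add 1).deriv
    simpa [pdu, coefG] using this
  have h0 : coefG f p ≠ 0 := by unfold coefG; positivity
  rw [rfun, kap2_eq (hf.differentiable (by simp)) hv, hG]
  congr 2
  field_simp

lemma contDiff_sqrt_coefE (hf : ContDiff ℝ (⊤ : ℕ∞) f) :
    ContDiff ℝ (⊤ : ℕ∞) fun p => √(coefE f p) := by
  have := hf.pdu
  unfold coefE
  exact ContDiff.sqrt (by fun_prop) fun p => by positivity

lemma contDiff_mongeArea (hf : ContDiff ℝ (⊤ : ℕ∞) f) : ContDiff ℝ (⊤ : ℕ∞) (mongeArea f) := by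
  have := hf.pdu
  have := hf.pdv
  unfold mongeArea
  exact ContDiff.sqrt (by fun_prop) fun p => by positivity

lemma mongeArea_pos (p : ℝ × ℝ) : 0 < mongeArea f p := by
  unfold mongeArea; positivity

lemma sqrt_coefE_pos (p : ℝ × ℝ) : 0 < √(coefE f p) := by
  unfold coefE; positivity

lemma contDiffAt_rfun {α : ℝ} {p : ℝ × ℝ} (hf : ContDiff ℝ (⊤ : ℕ∞) f) (hv : pdv f p = 0)
    (hα : sin α ≠ 0) (hvv : pdv (pdv f) p ≠ 0) : ContDiffAt ℝ (⊤ : ℕ∞) (rfun α f) p := by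
  have h1 := contDiff_sqrt_coefE hf
  have h2 := (contDiff_mongeArea hf).inv fun p => (mongeArea_pos p).ne'
  have h3 := hf.pdv
  have h4 := hf.pdv.pdu
  have h5 := hf.pdv.pdv
  have h6 : ContDiff ℝ (⊤ : ℕ∞) (coefG f) := by unfold coefG; fun_prop
  rw [rfun_eq α hf]
  refine ContDiffAt.div (ContDiff.contDiffAt (by fun_prop)) (ContDiff.contDiffAt ?_) ?_
  · exact (contDiff_const.mul ((contDiff_const.mul h3).mul h4)).sub
      ((contDiff_const.mul h1).mul (h5.mul h2))
  have hE := (sqrt_coefE_pos (f := f) p).ne'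
  have hW := (mongeArea_pos (f := f) p).ne'
  simp [hv, hα, hvv, hE, hW]

lemma contDiffAt_evolutoid {α : ℝ} {p : ℝ × ℝ} (hf : ContDiff ℝ (⊤ : ℕ∞) f) (hv : pdv f p = 0)
    (hα : sin α ≠ 0) (hvv : pdv (pdv f) p ≠ 0) : ContDiffAt ℝ (⊤ : ℕ∞) (evolutoid α f) p := by
  have h1 := (contDiff_sqrt_coefE hf).contDiffAt (x := p)
  have h2 := ((contDiff_mongeArea hf).inv fun p => (mongeArea_pos p).ne').contDiffAt (x := p)
  have h3 := hf.pdv.contDiffAt (x := p)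
  have h4 := hf.pdu.contDiffAt (x := p)
  have h5 := contDiffAt_rfun hf hv hα hvv
  have h6 := hf.contDiffAt (x := p)
  have h7 : ContDiffAt ℝ (⊤ : ℕ∞) (fun q => cos α / √(coefE f q)) p :=
    contDiffAt_const.div h1 (sqrt_coefE_pos p).ne'
  rw [evolutoid_eq α (hf.differentiable (by simp))]
  refine contDiffAt_pi.2 fun i => ?_
  fin_cases i
  · exact contDiffAt_fst.add (h5.mul (h7.sub ((contDiffAt_const.mul h2).mul h4)))
  · exact contDiffAt_snd.sub (((h5.mul contDiffAt_const).mul h2).mul h3)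
  · exact h6.add (h5.mul ((h7.mul h4).add (contDiffAt_const.mul h2)))

section Curve

variable {x y : ℝ → ℝ} {x' y' t : ℝ}

lemma hasDerivAt_sqrt_sq_add_sq_add_one (hx : HasDerivAt x x' t) (hy : HasDerivAt y y' t)
    (hx0 : x t = 0) (hy0 : y t = 0) : HasDerivAt (fun s => √(x s ^ 2 + y s ^ 2 + 1)) 0 t := by
  have := (((hx.pow 2).add (hy.pow 2)).add_const 1).sqrt (by simp [hx0, hy0])
  simpa [hx0, hy0] using this

lemma hasDerivAt_sqrt_one_add_sq (hx : HasDerivAt x x' t) (hx0 : x t = 0) :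
    HasDerivAt (fun s => √(1 + x s ^ 2)) 0 t := by
  have := ((hx.pow 2).const_add 1).sqrt (by simp [hx0])
  simpa [hx0] using this

/-- The derivatives along a curve of `r`, of `r sin α / W` and of the first and third components of
the evolutoid, at a point where the tangent plane is horizontal and `f_uv = 0`. -/
lemma hasDerivAt_along_curve {α κ d l : ℝ} {γ : ℝ → ℝ × ℝ} (hf : ContDiff ℝ (⊤ : ℕ∞) f)
    (hα : sin α ≠ 0) (hκ : κ ≠ 0) (hγ : Differentiable ℝ γ)
    (hu : pdu f (γ t) = 0) (hv : pdv f (γ t) = 0) (huv : pdu (pdv f) (γ t) = 0)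
    (hvv : pdv (pdv f) (γ t) = κ)
    (hl : HasDerivAt (fun s => pdu f (γ s)) l t)
    (hd : HasDerivAt (fun s => pdv (pdv f) (γ s)) d t) :
    HasDerivAt (fun s => rfun α f (γ s) * sin α * (mongeArea f (γ s))⁻¹) (-d / κ ^ 2) t ∧
    HasDerivAt (fun s => rfun α f (γ s) *
      (cos α / √(coefE f (γ s)) - sin α * (mongeArea f (γ s))⁻¹ * pdu f (γ s)))
      (-d / (sin α * κ ^ 2) * cos α - l / κ) t ∧
    HasDerivAt (fun s => rfun α f (γ s) *
      (cos α / √(coefE f (γ s)) * pdu f (γ s) + sin α * (mongeArea f (γ s))⁻¹))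
      (-d / κ ^ 2 + cos α * l / (sin α * κ)) t := by
  have hy : HasDerivAt (fun s => pdv f (γ s)) (deriv (fun s => pdv f (γ s)) t) t :=
    ((hf.pdv.differentiable (by simp)).comp hγ t).hasDerivAt
  have hz : HasDerivAt (fun s => pdu (pdv f) (γ s)) (deriv (fun s => pdu (pdv f) (γ s)) t) t :=
    ((hf.pdv.pdu.differentiable (by simp)).comp hγ t).hasDerivAt
  have hE : HasDerivAt (fun s => √(coefE f (γ s))) 0 t := hasDerivAt_sqrt_one_add_sq hl hu
  have hW : HasDerivAt (fun s => mongeArea f (γ s)) 0 t :=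
    hasDerivAt_sqrt_sq_add_sq_add_one hl hy hu hv
  have hG : HasDerivAt (fun s => coefG f (γ s)) 0 t := by
    simpa [hv, coefG] using (hy.pow 2).const_add 1
  have E0 : √(coefE f (γ t)) = 1 := by simp [coefE, hu]
  have W0 : mongeArea f (γ t) = 1 := by simp [mongeArea, hu, hv]
  have G0 : coefG f (γ t) = 1 := by simp [coefG, hv]
  have hWi : HasDerivAt (fun s => (mongeArea f (γ s))⁻¹) 0 t := by
    exact (hW.inv (by simp [W0])).congr_deriv (by simp)
  have hEi : HasDerivAt (fun s => cos α / √(coefE f (γ s))) 0 t := by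
    exact ((hasDerivAt_const t (cos α)).div hE (by simp [E0])).congr_deriv (by simp)
  have r0 : rfun α f (γ t) = 1 / (sin α * κ) := by
    rw [rfun_eq α hf]; simp only [E0, W0, G0, hv, huv, hvv]; field_simp; ring
  have hr : HasDerivAt (fun s => rfun α f (γ s)) (-d / (sin α * κ ^ 2)) t := by
    rw [rfun_eq α hf]
    have hnum := ((hE.const_mul 2).mul hG).neg
    have hden := (((hy.const_mul 2).mul hz).const_mul (cos α)).sub
      ((hE.const_mul (2 * sin α)).mul (hd.mul hWi))
    have hne : cos α * (2 * pdv f (γ t) * pdu (pdv f) (γ t)) -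
        2 * sin α * √(coefE f (γ t)) * (pdv (pdv f) (γ t) * (mongeArea f (γ t))⁻¹) ≠ 0 := by
      simp [E0, W0, hv, hvv, hα, hκ]
    refine (hnum.div hden hne).congr_deriv ?_
    simp [E0, W0, G0, hv, huv, hvv]
    field_simp
  refine ⟨?_, ?_, ?_⟩
  · refine ((hr.mul_const (sin α)).mul hWi).congr_deriv ?_
    simp [W0]; field_simp
  · refine (hr.mul (hEi.sub ((hWi.const_mul (sin α)).mul hl))).congr_deriv ?_
    simp [E0, W0, hu, r0]; field_simp; ring
  · refine (hr.mul ((hEi.mul hl).add (hWi.const_mul (sin α)))).congr_deriv ?_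
    simp [E0, W0, hu, r0]; field_simp

end Curve

lemma lagrange_dot3_cross3 (a b : Fin 3 → ℝ) :
    norm3 a ^ 2 * norm3 b ^ 2 - dot3 a b ^ 2 = dot3 (cross3 a b) (cross3 a b) := by
  have h (c : Fin 3 → ℝ) : 0 ≤ dot3 c c := by
    unfold dot3
    linarith [mul_self_nonneg (c 0), mul_self_nonneg (c 1), mul_self_nonneg (c 2)]
  rw [norm3, norm3, Real.sq_sqrt (h a), Real.sq_sqrt (h b)]
  simp [dot3, cross3]
  ring

/-- If the tangent plane of an immersion is orthogonal to the second coordinate axis, then the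
vanishing of the Gaussian curvature is read off from the second component. -/
lemma gaussK_eq_zero_iff {ψ : ℝ × ℝ → Fin 3 → ℝ} {p : ℝ × ℝ} (hu : pdu ψ p 1 = 0)
    (hv : pdv ψ p 1 = 0) (hn : pdu ψ p 2 * pdv ψ p 0 - pdu ψ p 0 * pdv ψ p 2 ≠ 0) :
    gaussK ψ p = 0 ↔ pdu (pdu ψ) p 1 * pdv (pdv ψ) p 1 - pdu (pdv ψ) p 1 ^ 2 = 0 := by
  set e := pdu ψ p 2 * pdv ψ p 0 - pdu ψ p 0 * pdv ψ p 2 with he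
  have hc : cross3 (pdu ψ p) (pdv ψ p) = ![0, e, 0] := by simp [cross3, hu, hv, he]
  have hd : dot3 ![0, e, 0] ![0, e, 0] = e ^ 2 := by simp [dot3, sq]
  have hN : norm3 ![0, e, 0] ≠ 0 := by
    rw [norm3, hd, Real.sqrt_sq_eq_abs]; exact abs_ne_zero.2 hn
  have hdot (b : Fin 3 → ℝ) : dot3 b (unitNormal ψ p) = b 1 * ((norm3 ![0, e, 0])⁻¹ * e) := by
    rw [unitNormal, hc]; simp [dot3]
  rw [gaussK, lagrange_dot3_cross3, hc, hd, hdot, hdot, hdot,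
    div_eq_zero_iff, or_iff_left (pow_ne_zero 2 hn)]
  have hk : (norm3 ![0, e, 0])⁻¹ * e ≠ 0 := mul_ne_zero (inv_ne_zero hN) hn
  set k := (norm3 ![0, e, 0])⁻¹ * e
  rw [show ∀ A B C : ℝ, A * k * (B * k) - (C * k) ^ 2 = (A * B - C ^ 2) * k ^ 2 by intros; ring,
    mul_eq_zero, or_iff_left (pow_ne_zero 2 hk)]

end Evolutoid

theorem evolutoid_parabolic_iff_subparabolic
    (α κ₁ κ₂ : ℝ) (a : ℕ → ℕ → ℝ) (f : ℝ × ℝ → ℝ)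
    (hα : α ∈ Set.Ioo 0 (Real.pi / 2))
    (hκ : κ₂ < κ₁) (hκ₁ : κ₁ ≠ 0) (hκ₂ : κ₂ ≠ 0)
    (hf : MongeHyp κ₁ κ₂ a f)
    (ha03 : a 0 3 ≠ 0) (hne : Real.sin α ^ 2 * κ₂ ≠ κ₁) :
    gaussK (evolutoid α f) (0, 0) = 0 ↔ a 2 1 = 0 := by
  obtain ⟨hs, hf0, hu, hv, huu, huv, hvv, hij⟩ := hf
  have a21 : pdu (pdu (pdv f)) (0, 0) = a 2 1 := hij 2 1 (by norm_num) (by norm_num)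
  have a12 : pdu (pdv (pdv f)) (0, 0) = a 1 2 := hij 1 2 (by norm_num) (by norm_num)
  have a03 : pdv (pdv (pdv f)) (0, 0) = a 0 3 := hij 0 3 (by norm_num) (by norm_num)
  replace huu : pdu (pdu f) (0, 0) = κ₁ := huu
  replace huv : pdu (pdv f) (0, 0) = 0 := huv
  replace hvv : pdv (pdv f) (0, 0) = κ₂ := hvv
  have hvu : pdv (pdu f) (0, 0) = 0 := by rw [← pdu_pdv_comm hs, huv]
  have hsin : sin α ≠ 0 := (sin_pos_of_pos_of_lt_pi hα.1 (by linarith [hα.2, pi_pos])).ne'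
  have hfd : Differentiable ℝ f := hs.differentiable (by simp)
  have hvv0 : pdv (pdv f) (0, 0) ≠ 0 := by rwa [hvv]
  have du := (hs.pdu.differentiable (by simp)) (0, 0)
  have dvv := (hs.pdv.pdv.differentiable (by simp)) (0, 0)
  obtain ⟨mu, xu, zu⟩ := hasDerivAt_along_curve (γ := fun t => (t, 0)) (t := 0) hs hsin hκ₂
    (by fun_prop) hu hv huv hvv (huu ▸ du.hasDerivAt_pdu) (a12 ▸ dvv.hasDerivAt_pdu)
  obtain ⟨mv, xv, zv⟩ := hasDerivAt_along_curve (γ := fun t => (0, t)) (t := 0) hs hsin hκ₂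
    (by fun_prop) hu hv huv hvv (hvu ▸ du.hasDerivAt_pdv) (a03 ▸ dvv.hasDerivAt_pdv)
  set m : ℝ × ℝ → ℝ := fun p => rfun α f p * sin α * (mongeArea f p)⁻¹ with hm
  have hmC : ContDiffAt ℝ 2 m (0, 0) := by
    have h := ((contDiffAt_rfun hs hv hsin hvv0).mul (contDiffAt_const (c := sin α))).mul
      ((contDiff_mongeArea hs).inv fun p => (mongeArea_pos p).ne').contDiffAt
    exact h.of_le two_le_infty
  have hFC : ContDiffAt ℝ 2 (pdv f) (0, 0) :=
    hs.pdv.contDiffAt.of_le two_le_infty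
  have hψ : ContDiffAt ℝ 2 (evolutoid α f) (0, 0) :=
    (contDiffAt_evolutoid hs hv hsin hvv0).of_le two_le_infty
  have m0 : m (0, 0) = 1 / κ₂ := by
    simp only [hm, rfun_eq α hs, coefE, coefG, mongeArea, hu, hv, hvv]
    simp
    field_simp
  have mu' : pdu m (0, 0) = -a 1 2 / κ₂ ^ 2 := mu.deriv
  have mv' : pdv m (0, 0) = -a 0 3 / κ₂ ^ 2 := mv.deriv
  have hcomp : (fun q => evolutoid α f q 1) = fun q => q.2 - m q * pdv f q := by
    rw [evolutoid_eq α hfd]; rfl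
  have eψ := eventually_differentiableAt (n := 1) hψ
  have dψ := eψ.self_of_nhds
  have dψu := (hψ.pdu (n := 1)).differentiableAt (by simp)
  have dψv := (hψ.pdv (n := 1)).differentiableAt (by simp)
  have eu : (fun q => pdu (evolutoid α f) q 1) =ᶠ[nhds (0, 0)]
      pdu fun q => q.2 - m q * pdv f q := by
    filter_upwards [eψ] with q hq
    rw [pdu_apply hq, hcomp]
  have ev : (fun q => pdv (evolutoid α f) q 1) =ᶠ[nhds (0, 0)]
      pdv fun q => q.2 - m q * pdv f q := by
    filter_upwards [eψ] with q hq
    rw [pdv_apply hq, hcomp]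
  obtain ⟨suu, suv, svv⟩ := second_partials_snd_sub_mul hmC hFC hv
  rw [← pdu_congr eu, ← pdu_apply dψu, mu', m0, huv, a21] at suu
  rw [← pdu_congr ev, ← pdu_apply dψv, mu', mv', m0, huv, hvv, a12] at suv
  rw [← pdv_congr ev, ← pdv_apply dψv, mv', m0, hvv, a03] at svv
  have dm := hmC.differentiableAt (by simp)
  have dF := hFC.differentiableAt (by simp)
  have u1 : pdu (evolutoid α f) (0, 0) 1 = 0 := by
    rw [show pdu (evolutoid α f) (0, 0) 1 = _ from eu.self_of_nhds, pdu_sub_mul (by fun_prop) dm dF, pdu_snd, hv, huv]; ring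
  have v1 : pdv (evolutoid α f) (0, 0) 1 = 0 := by
    rw [show pdv (evolutoid α f) (0, 0) 1 = _ from ev.self_of_nhds, pdv_sub_mul (by fun_prop) dm dF, pdv_snd, hv, hvv, m0]; field_simp; ring
  have u0 : pdu (evolutoid α f) (0, 0) 0 =
      1 + (-a 1 2 / (sin α * κ₂ ^ 2) * cos α - κ₁ / κ₂) := by
    rw [pdu_apply dψ, evolutoid_eq α hfd]
    exact ((hasDerivAt_id (0 : ℝ)).add xu).deriv
  have u2 : pdu (evolutoid α f) (0, 0) 2 =
      0 + (-a 1 2 / κ₂ ^ 2 + cos α * κ₁ / (sin α * κ₂)) := by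
    rw [pdu_apply dψ, evolutoid_eq α hfd]
    have h := ((hfd (0, 0)).hasDerivAt_pdu.add zu).deriv
    rw [hu] at h
    exact h
  have v0 : pdv (evolutoid α f) (0, 0) 0 =
      0 + (-a 0 3 / (sin α * κ₂ ^ 2) * cos α - 0 / κ₂) := by
    rw [pdv_apply dψ, evolutoid_eq α hfd]
    exact ((hasDerivAt_const (0 : ℝ) (0 : ℝ)).add xv).deriv
  have v2 : pdv (evolutoid α f) (0, 0) 2 =
      0 + (-a 0 3 / κ₂ ^ 2 + cos α * 0 / (sin α * κ₂)) := by
    rw [pdv_apply dψ, evolutoid_eq α hfd]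
    have h := ((hfd (0, 0)).hasDerivAt_pdv.add zv).deriv
    rw [hv] at h
    exact h
  have hn : pdu (evolutoid α f) (0, 0) 2 * pdv (evolutoid α f) (0, 0) 0 -
      pdu (evolutoid α f) (0, 0) 0 * pdv (evolutoid α f) (0, 0) 2 ≠ 0 := by
    have h : pdu (evolutoid α f) (0, 0) 2 * pdv (evolutoid α f) (0, 0) 0 -
        pdu (evolutoid α f) (0, 0) 0 * pdv (evolutoid α f) (0, 0) 2 =
        a 0 3 * (sin α ^ 2 * κ₂ - κ₁) / (sin α ^ 2 * κ₂ ^ 3) := by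
      rw [u0, u2, v0, v2]
      field_simp
      linear_combination (-κ₁ * κ₂ * a 0 3) * sin_sq_add_cos_sq α
    rw [h]
    exact div_ne_zero (mul_ne_zero ha03 (sub_ne_zero.2 hne)) (by positivity)
  have huv0 : pdu (pdv (evolutoid α f)) (0, 0) 1 = 0 := by
    rw [suv]; field_simp; ring
  have hvv1 : pdv (pdv (evolutoid α f)) (0, 0) 1 = a 0 3 / κ₂ := by
    rw [svv]; field_simp; ring
  have huu1 : pdu (pdu (evolutoid α f)) (0, 0) 1 = -a 2 1 / κ₂ := by
    rw [suu]; ring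
  rw [gaussK_eq_zero_iff u1 v1 hn, huv0, hvv1, huu1]
  simp [ha03, hκ₂]
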